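/- arXiv:math/9809179 — 3 statements merged into one kernel-verified Lean document; each statement's English description precedes it below -/
import Mathlib

section
/- Let D be a bounded Lipschitz domain in R^n (n ≥ 2) containing the origin, and let 0 < α < 2. If f : R^n → R is a measurable function supported on the complement of D with ∫_{D^c} |f(z)| |z|^{-(n+α)} dz < ∞, and if ∫_{D^c} f(z) / |y - z|^{n+α} dz = 0 for every y ∈ D, then f = 0 almost everywhere on D^c. -/
open MeasureTheory Metric Filter Set Topology
open scoped ENNReal NNReal Topology

noncomputable section

/-- Euclidean space `ℝⁿ`. -/
abbrev EucSp (n : ℕ) := EuclideanSpace ℝ (Fin n)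

variable {n : ℕ}

/-- The first exit time of a path `ω` from a set `U` (`∞` if the path never leaves `U`). -/
def exitTime (U : Set (EucSp n)) (ω : ℝ≥0 → EucSp n) : ℝ≥0∞ :=
  ⨅ s ∈ {s : ℝ≥0 | ω s ∉ U}, (s : ℝ≥0∞)

/-- The position of the path at the exit time from `U`. -/
def exitPos (U : Set (EucSp n)) (ω : ℝ≥0 → EucSp n) : EucSp n :=
  ω (exitTime U ω).toNNReal

/-- The Poisson kernel of the ball `B(c,r)` for the rotationally symmetric `α`-stable
process (Blumenthal–Getoor–Ray):
`K(x,z) = C(n,α) ((r²-|x-c|²)/(|z-c|²-r²))^{α/2} |x-z|^{-n}` for `|z-c| > r`, `0` otherwise. -/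
def stableBallKernel (n : ℕ) (α : ℝ) (c : EucSp n) (r : ℝ) (x z : EucSp n) : ℝ :=
  if r < ‖z - c‖ then
    Real.Gamma ((n : ℝ) / 2) * Real.pi ^ (-(n : ℝ) / 2 - 1) * Real.sin (Real.pi * α / 2) *
      ((r ^ 2 - ‖x - c‖ ^ 2) / (‖z - c‖ ^ 2 - r ^ 2)) ^ (α / 2) * ‖x - z‖ ^ (-(n : ℝ))
  else 0

/-- An abstract symmetric `α`-stable process on `ℝⁿ`, described by the family of laws
`law x` on path space of the process started at `x`.  The exit distribution from any ball
is required to be given by the explicit Blumenthal–Getoor–Ray Poisson kernel, which pins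
down the process. -/
structure StableProcessLaw (n : ℕ) (α : ℝ) where
  law : EucSp n → Measure (ℝ≥0 → EucSp n)
  prob : ∀ x, IsProbabilityMeasure (law x)
  start : ∀ x, law x {ω | ω 0 = x} = 1
  ball_exit : ∀ (c : EucSp n) (r : ℝ), 0 < r → ∀ x ∈ ball c r,
    (law x).map (exitPos (ball c r)) =
      volume.withDensity fun z => ENNReal.ofReal (stableBallKernel n α c r x z)

/-- The harmonic measure of `U`: the law of `X_{τ_U}` under `P_x`. -/
def StableProcessLaw.hm {α : ℝ} (H : StableProcessLaw n α) (U : Set (EucSp n))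
    (x : EucSp n) : Measure (EucSp n) :=
  (H.law x).map (exitPos U)

/-- The Green function of the (transient) symmetric `α`-stable process on `ℝⁿ`:
`G(x,y) = 2^{-α} π^{-n/2} Γ((n-α)/2) Γ(α/2)⁻¹ |x-y|^{α-n}`. -/
def freeGreen (n : ℕ) (α : ℝ) (x y : EucSp n) : ℝ :=
  2 ^ (-α) * Real.pi ^ (-(n : ℝ) / 2) * Real.Gamma (((n : ℝ) - α) / 2) / Real.Gamma (α / 2) *
    ‖x - y‖ ^ (α - (n : ℝ))

/-- The Green function of the process killed upon leaving `D`: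
`G_D(x,y) = G(x,y) - E_x[G(X_{τ_D},y)]`. -/
def killedGreen {α : ℝ} (H : StableProcessLaw n α) (D : Set (EucSp n)) (x y : EucSp n) : ℝ :=
  freeGreen n α x y - ∫ z, freeGreen n α z y ∂(H.hm D x)

/-- The Martin quotient `M_D(x,y) = G_D(x,y)/G_D(x₀,y)` with base point `x₀`. -/
def martinQuot {α : ℝ} (H : StableProcessLaw n α) (D : Set (EucSp n)) (x₀ x y : EucSp n) : ℝ :=
  killedGreen H D x y / killedGreen H D x₀ y

/-- The Martin kernel at a boundary point `z`:
`M_D(x,z) = lim_{D ∋ y → z} G_D(x,y)/G_D(x₀,y)`. -/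
def martinKernel {α : ℝ} (H : StableProcessLaw n α) (D : Set (EucSp n)) (x₀ x z : EucSp n) : ℝ :=
  limUnder (𝓝[D] z) (martinQuot H D x₀ x)

/-- A bounded domain: a bounded, open, connected set. -/
def IsBoundedDomain (D : Set (EucSp n)) : Prop :=
  IsOpen D ∧ IsConnected D ∧ Bornology.IsBounded D

/-- A bounded Lipschitz domain: near every boundary point, after an isometric change of
coordinates, `D` is the region above the graph of a Lipschitz function (with uniform
characteristic constants `(r₀, A₀)`). -/
def IsLipschitzDomain [NeZero n] (D : Set (EucSp n)) : Prop :=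
  IsBoundedDomain D ∧
  ∃ r₀ A₀ : ℝ, 0 < r₀ ∧ 0 < A₀ ∧
    ∀ z ∈ frontier D, ∃ (ψ : EucSp n ≃ₗᵢ[ℝ] EucSp n) (f : EucSp n → ℝ),
      LipschitzWith (Real.toNNReal A₀) f ∧
      ∀ y ∈ ball z r₀,
        (y ∈ D ↔
          f (ψ (y - z) - (ψ (y - z) 0) • EuclideanSpace.single (0 : Fin n) (1 : ℝ))
            < ψ (y - z) 0)

/-- A bounded `C^{1,1}` domain: near every boundary point, after an isometric change of
coordinates, `D` is the region above the graph of a `C¹` function with Lipschitz gradient. -/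
def IsC11Domain [NeZero n] (D : Set (EucSp n)) : Prop :=
  IsBoundedDomain D ∧
  ∃ r₀ : ℝ, 0 < r₀ ∧
    ∀ z ∈ frontier D, ∃ (ψ : EucSp n ≃ₗᵢ[ℝ] EucSp n) (f : EucSp n → ℝ) (M : ℝ≥0),
      ContDiff ℝ 1 f ∧ LipschitzWith M (fderiv ℝ f) ∧
      ∀ y ∈ ball z r₀,
        (y ∈ D ↔
          f (ψ (y - z) - (ψ (y - z) 0) • EuclideanSpace.single (0 : Fin n) (1 : ℝ))
            < ψ (y - z) 0)

/-- The uniform exterior cone condition: there are `η, r > 0` such that at every boundary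
point `z` there is a cone with vertex `z`, isometric to the standard cone of aperture `η`,
whose intersection with `B(z,r)` lies in `Dᶜ`. -/
def UniformExteriorCone [NeZero n] (D : Set (EucSp n)) : Prop :=
  ∃ η r : ℝ, 0 < η ∧ 0 < r ∧ ∀ z ∈ frontier D,
    ∃ ψ : EucSp n ≃ₗᵢ[ℝ] EucSp n, ∀ y ∈ ball z r,
      (0 < ψ (y - z) 0 ∧
        ‖ψ (y - z) - (ψ (y - z) 0) • EuclideanSpace.single (0 : Fin n) (1 : ℝ)‖
          < η * ψ (y - z) 0) → y ∈ Dᶜ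

/-- `h` is harmonic in `D` with respect to the whole process `X` (Definition 2.2):
continuous in `D`, locally integrable, with `∫_{|x|>1} |h(x)| |x|^{-(n+α)} dx < ∞`, and
satisfying the exact mean value property `h(x) = E_x[h(X_{τ_{B(x,r)}})]` for every ball with
closure contained in `D`. -/
def HarmonicWrtX {α : ℝ} (H : StableProcessLaw n α) (D : Set (EucSp n))
    (h : EucSp n → ℝ) : Prop :=
  ContinuousOn h D ∧ LocallyIntegrable h volume ∧
  Integrable (fun x => |h x| * ‖x‖ ^ (-(n : ℝ) - α)) (volume.restrict {x : EucSp n | 1 < ‖x‖}) ∧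
  ∀ x ∈ D, ∀ r : ℝ, 0 < r → closedBall x r ⊆ D →
    Integrable h (H.hm (ball x r) x) ∧ h x = ∫ y, h y ∂(H.hm (ball x r) x)

/-- `h` is superharmonic in `D` with respect to the whole process `X` (Definition 2.2):
lower semicontinuous in `D`, locally integrable, with `∫_{|x|>1}|h(x)||x|^{-(n+α)}dx < ∞`,
and `h(x) ≥ E_x[h(X_{τ_{B(x,r)}})]` (in the extended sense) for every ball with closure in
`D`. -/
def SuperharmonicWrtX {α : ℝ} (H : StableProcessLaw n α) (D : Set (EucSp n))
    (h : EucSp n → ℝ) : Prop :=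
  LowerSemicontinuousOn h D ∧ LocallyIntegrable h volume ∧
  Integrable (fun x => |h x| * ‖x‖ ^ (-(n : ℝ) - α)) (volume.restrict {x : EucSp n | 1 < ‖x‖}) ∧
  ∀ x ∈ D, ∀ r : ℝ, 0 < r → closedBall x r ⊆ D →
    Integrable (fun y => max (-(h y)) 0) (H.hm (ball x r) x) ∧
    ((∫⁻ y, ENNReal.ofReal (h y) ∂(H.hm (ball x r) x) : ℝ≥0∞) : EReal)
      - ((∫⁻ y, ENNReal.ofReal (-(h y)) ∂(H.hm (ball x r) x) : ℝ≥0∞) : EReal) ≤ (h x : EReal)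

/-- `h` is harmonic in `D` with respect to the killed process `X^D` (Definition 2.1):
continuous in `D`, locally integrable on `D`, with `∫_{D, |x|>1}|h(x)||x|^{-(n+α)}dx < ∞`,
and `h(x) = E_x[h(X_{τ_{B(x,r)}}); τ_{B(x,r)} < τ_D]` for every ball with closure in `D`
(the event `τ_{B(x,r)} < τ_D` being `X_{τ_{B(x,r)}} ∈ D`). -/
def HarmonicWrtKilled {α : ℝ} (H : StableProcessLaw n α) (D : Set (EucSp n))
    (h : EucSp n → ℝ) : Prop :=
  ContinuousOn h D ∧ LocallyIntegrableOn h D volume ∧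
  Integrable (fun x => |h x| * ‖x‖ ^ (-(n : ℝ) - α))
    (volume.restrict ({x : EucSp n | 1 < ‖x‖} ∩ D)) ∧
  ∀ x ∈ D, ∀ r : ℝ, 0 < r → closedBall x r ⊆ D →
    IntegrableOn h D (H.hm (ball x r) x) ∧ h x = ∫ y in D, h y ∂(H.hm (ball x r) x)

/-- `h` is superharmonic in `D` with respect to the killed process `X^D` (Definition 2.1). -/
def SuperharmonicWrtKilled {α : ℝ} (H : StableProcessLaw n α) (D : Set (EucSp n))
    (h : EucSp n → ℝ) : Prop :=
  LowerSemicontinuousOn h D ∧ LocallyIntegrableOn h D volume ∧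
  Integrable (fun x => |h x| * ‖x‖ ^ (-(n : ℝ) - α))
    (volume.restrict ({x : EucSp n | 1 < ‖x‖} ∩ D)) ∧
  ∀ x ∈ D, ∀ r : ℝ, 0 < r → closedBall x r ⊆ D →
    IntegrableOn (fun y => max (-(h y)) 0) D (H.hm (ball x r) x) ∧
    ((∫⁻ y in D, ENNReal.ofReal (h y) ∂(H.hm (ball x r) x) : ℝ≥0∞) : EReal)
      - ((∫⁻ y in D, ENNReal.ofReal (-(h y)) ∂(H.hm (ball x r) x) : ℝ≥0∞) : EReal)
      ≤ (h x : EReal)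

/-- The limit of the path at its lifetime (exit time from `D`), if it exists. -/
def pathBoundaryLimit (D : Set (EucSp n)) (ω : ℝ≥0 → EucSp n) : EucSp n :=
  limUnder (𝓝[{t : ℝ≥0 | (t : ℝ≥0∞) < exitTime D ω}] (exitTime D ω).toNNReal) ω

/-- The kernel `⟨v, x⟩ ^ m ‖x‖ ^ (-p)`. -/
def polyRieszKernel {E : Type*} [NormedAddCommGroup E] [InnerProductSpace ℝ E]
    (v : E) (m : ℕ) (p : ℝ) (x : E) : ℝ :=
  inner ℝ v x ^ m * ‖x‖ ^ (-p)

section Kernel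

variable {E : Type*} [NormedAddCommGroup E] [InnerProductSpace ℝ E]

lemma hasDerivAt_polyRieszKernel (v : E) (m : ℕ) (p : ℝ) (y : E) (t : ℝ) (h : y + t • v ≠ 0) :
    HasDerivAt (fun t : ℝ => polyRieszKernel v m p (y + t • v))
      (m * ‖v‖ ^ 2 * polyRieszKernel v (m - 1) p (y + t • v)
        - p * polyRieszKernel v (m + 1) (p + 2) (y + t • v)) t := by
  have hpos : 0 < ‖y + t • v‖ := norm_pos_iff.2 h
  have hline : HasDerivAt (fun t : ℝ => y + t • v) v t := by
    simpa using ((hasDerivAt_id t).smul_const v).const_add y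
  have hinner : HasDerivAt (fun t : ℝ => inner ℝ v (y + t • v)) (‖v‖ ^ 2) t := by
    simpa using (hasDerivAt_const t v).inner ℝ hline
  have hnorm : HasDerivAt (fun t : ℝ => ‖y + t • v‖ ^ (-p))
      (-p * ‖y + t • v‖ ^ (-(p + 2)) * inner ℝ v (y + t • v)) t := by
    have h1 := hline.norm_sq.rpow_const (p := -p / 2) (Or.inl (by positivity))
    convert h1 using 1
    · ext s
      rw [← Real.rpow_natCast, ← Real.rpow_mul (norm_nonneg _)]
      congr 1; push_cast; ring
    · rw [← Real.rpow_natCast, ← Real.rpow_mul (norm_nonneg _), real_inner_comm]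
      rw [show ((2 : ℕ) : ℝ) * (-p / 2 - 1) = -(p + 2) by push_cast; ring]
      ring
  refine ((hinner.pow m).mul hnorm).congr_deriv ?_
  simp only [polyRieszKernel, Pi.pow_apply]
  ring

lemma abs_polyRieszKernel_le (v : E) (m : ℕ) {p s r : ℝ} (hs : 0 ≤ s) (hr : 0 < r)
    (hp : s + m ≤ p) {x z : E} (hxr : r ≤ ‖x‖) (hz : z ≠ 0) (hxz : ‖z‖ / 2 ≤ ‖x‖) :
    |polyRieszKernel v m p x| ≤ ‖v‖ ^ m * 2 ^ s * r ^ (-(p - m - s)) * ‖z‖ ^ (-s) := by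
  have hx : 0 < ‖x‖ := hr.trans_le hxr
  have hz' : 0 < ‖z‖ := norm_pos_iff.2 hz
  have h1 : ‖x‖ ^ (-p) = ‖x‖ ^ (-(m : ℝ)) * ‖x‖ ^ (-s) * ‖x‖ ^ (-(p - m - s)) := by
    rw [← Real.rpow_add hx, ← Real.rpow_add hx]; ring_nf
  have h2 : ‖x‖ ^ m * ‖x‖ ^ (-(m : ℝ)) = 1 := by
    rw [Real.rpow_neg hx.le, Real.rpow_natCast, mul_inv_cancel₀ (by positivity)]
  have h3 : ‖x‖ ^ (-s) ≤ 2 ^ s * ‖z‖ ^ (-s) := by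
    have := Real.rpow_le_rpow_of_nonpos (by positivity) hxz (neg_nonpos.2 hs)
    rwa [Real.div_rpow hz'.le (by norm_num), Real.rpow_neg (by norm_num : (0 : ℝ) ≤ 2), div_inv_eq_mul,
      mul_comm] at this
  have h4 : ‖x‖ ^ (-(p - m - s)) ≤ r ^ (-(p - m - s)) :=
    Real.rpow_le_rpow_of_nonpos hr hxr (by linarith)
  have h5 : |inner ℝ v x| ^ m ≤ ‖v‖ ^ m * ‖x‖ ^ m := by
    rw [← mul_pow]; gcongr; exact abs_real_inner_le_norm v x
  calc |polyRieszKernel v m p x| = |inner ℝ v x| ^ m * ‖x‖ ^ (-p) := by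
        rw [polyRieszKernel, abs_mul, abs_pow, abs_of_nonneg (Real.rpow_nonneg hx.le _)]
    _ ≤ ‖v‖ ^ m * ‖x‖ ^ m * ‖x‖ ^ (-p) := by gcongr
    _ = ‖v‖ ^ m * (‖x‖ ^ m * ‖x‖ ^ (-(m : ℝ))) * ‖x‖ ^ (-s) * ‖x‖ ^ (-(p - m - s)) := by
        rw [h1]; ring
    _ = ‖v‖ ^ m * ‖x‖ ^ (-s) * ‖x‖ ^ (-(p - m - s)) := by rw [h2, mul_one]
    _ ≤ ‖v‖ ^ m * (2 ^ s * ‖z‖ ^ (-s)) * r ^ (-(p - m - s)) := by gcongr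
    _ = _ := by ring

lemma half_norm_le_norm_sub {F : Type*} [NormedAddCommGroup F] {y z : F} {r : ℝ}
    (hy : ‖y‖ < r) (hz : 2 * r ≤ ‖z‖) :
    r ≤ ‖y - z‖ ∧ ‖z‖ / 2 ≤ ‖y - z‖ := by
  have := norm_sub_norm_le z y
  rw [norm_sub_rev] at this
  constructor <;> linarith

lemma norm_mul_polyRieszKernel_le (v : E) (m : ℕ) {p s r : ℝ} (hs : 0 ≤ s) (hr : 0 < r)
    (hp : s + m ≤ p) (a : ℝ) {y z : E} (hy : ‖y‖ < r) (hz : 2 * r ≤ ‖z‖) :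
    ‖a * polyRieszKernel v m p (y - z)‖ ≤
      ‖v‖ ^ m * 2 ^ s * r ^ (-(p - m - s)) * ‖a * ‖z‖ ^ (-s)‖ := by
  obtain ⟨h1, h2⟩ := half_norm_le_norm_sub hy hz
  have hz0 : z ≠ 0 := norm_pos_iff.1 (by linarith)
  have := abs_polyRieszKernel_le v m hs hr hp h1 hz0 h2
  rw [norm_mul, norm_mul, Real.norm_eq_abs (polyRieszKernel _ _ _ _),
    Real.norm_of_nonneg (Real.rpow_nonneg (norm_nonneg z) _)]
  calc ‖a‖ * _ ≤ ‖a‖ * _ := mul_le_mul_of_nonneg_left this (norm_nonneg a)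
    _ = _ := by ring

lemma measurable_polyRieszKernel [MeasurableSpace E] [BorelSpace E] [SecondCountableTopology E]
    (v : E) (m : ℕ) (p : ℝ) : Measurable (polyRieszKernel v m p) := by
  unfold polyRieszKernel
  fun_prop

end Kernel

section Integral

variable {E : Type*} [NormedAddCommGroup E] [InnerProductSpace ℝ E] [MeasurableSpace E]
  [BorelSpace E] [SecondCountableTopology E] {μ : Measure E} {f : E → ℝ} {s r : ℝ}

lemma integrable_mul_polyRieszKernel (hfm : Measurable f)
    (hf : Integrable (fun z => f z * ‖z‖ ^ (-s)) μ) (hμ : ∀ᵐ z ∂μ, 2 * r ≤ ‖z‖)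
    (v : E) (m : ℕ) {p : ℝ} (hs : 0 ≤ s) (hr : 0 < r) (hp : s + m ≤ p)
    {y : E} (hy : ‖y‖ < r) :
    Integrable (fun z => f z * polyRieszKernel v m p (y - z)) μ := by
  refine (hf.norm.const_mul (‖v‖ ^ m * 2 ^ s * r ^ (-(p - m - s)))).mono' ?_ ?_
  · exact (hfm.mul ((measurable_polyRieszKernel v m p).comp
      (measurable_const.sub measurable_id))).aestronglyMeasurable
  · filter_upwards [hμ] with z hz using norm_mul_polyRieszKernel_le v m hs hr hp _ hy hz

/-- Differentiation under the integral sign for the potentials of `polyRieszKernel`. -/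
lemma hasDerivAt_integral_polyRieszKernel (hfm : Measurable f)
    (hf : Integrable (fun z => f z * ‖z‖ ^ (-s)) μ) (hμ : ∀ᵐ z ∂μ, 2 * r ≤ ‖z‖)
    (v : E) (m : ℕ) {p : ℝ} (hs : 0 ≤ s) (hr : 0 < r) (hp : s + m ≤ p)
    {y : E} (hy : ‖y‖ < r) :
    HasDerivAt (fun t : ℝ => ∫ z, f z * polyRieszKernel v m p (y + t • v - z) ∂μ)
      (m * ‖v‖ ^ 2 * ∫ z, f z * polyRieszKernel v (m - 1) p (y - z) ∂μ
        - p * ∫ z, f z * polyRieszKernel v (m + 1) (p + 2) (y - z) ∂μ) 0 := by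
  have hp1 : s + (m - 1 : ℕ) ≤ p := by
    have : ((m - 1 : ℕ) : ℝ) ≤ m := by exact_mod_cast Nat.sub_le m 1
    linarith
  have hp2 : s + (m + 1 : ℕ) ≤ p + 2 := by push_cast; linarith
  set U : Set ℝ := {t | ‖y + t • v‖ < r} with hU
  have hU0 : U ∈ 𝓝 (0 : ℝ) := by
    apply (isOpen_lt (by fun_prop) continuous_const).mem_nhds
    simpa using hy
  let F' : ℝ → E → ℝ := fun t z =>
    m * ‖v‖ ^ 2 * (f z * polyRieszKernel v (m - 1) p (y + t • v - z))
      - p * (f z * polyRieszKernel v (m + 1) (p + 2) (y + t • v - z))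
  have hmeas : ∀ k q (x : E), Measurable fun z => f z * polyRieszKernel v k q (x - z) :=
    fun k q x => hfm.mul ((measurable_polyRieszKernel v k q).comp
      (measurable_const.sub measurable_id))
  have key := hasDerivAt_integral_of_dominated_loc_of_deriv_le (μ := μ) (s := U) (x₀ := (0 : ℝ))
    (F := fun t z => f z * polyRieszKernel v m p (y + t • v - z)) (F' := F')
    (bound := fun z =>
      |m * ‖v‖ ^ 2| * (‖v‖ ^ (m - 1) * 2 ^ s * r ^ (-(p - (m - 1 : ℕ) - s)) * ‖f z * ‖z‖ ^ (-s)‖)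
      + |p| * (‖v‖ ^ (m + 1) * 2 ^ s * r ^ (-(p + 2 - (m + 1 : ℕ) - s)) * ‖f z * ‖z‖ ^ (-s)‖))
    hU0 (Eventually.of_forall fun t => (hmeas _ _ _).aestronglyMeasurable)
    (by simpa using integrable_mul_polyRieszKernel hfm hf hμ v m hs hr hp hy)
    (((hmeas _ _ _).const_mul _).sub ((hmeas _ _ _).const_mul _)).aestronglyMeasurable
    (by
      filter_upwards [hμ] with z hz t ht
      refine (norm_sub_le _ _).trans ?_
      rw [norm_mul, norm_mul p]
      exact add_le_add
        (mul_le_mul_of_nonneg_left (norm_mul_polyRieszKernel_le v _ hs hr hp1 _ ht hz)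
          (abs_nonneg _))
        (mul_le_mul_of_nonneg_left (norm_mul_polyRieszKernel_le v _ hs hr hp2 _ ht hz)
          (abs_nonneg _)))
    (((hf.norm.const_mul _).const_mul _).add ((hf.norm.const_mul _).const_mul _))
    (by
      filter_upwards [hμ] with z hz t ht
      have hne : (y - z) + t • v ≠ 0 := by
        have := (half_norm_le_norm_sub ht hz).1
        rw [show (y - z) + t • v = y + t • v - z by abel]
        exact norm_pos_iff.1 (hr.trans_le this)
      have h := (hasDerivAt_polyRieszKernel v m p (y - z) t hne).const_mul (f z)
      simp only [show ∀ t : ℝ, (y - z) + t • v = y + t • v - z from fun t => by abel] at h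
      refine h.congr_deriv ?_
      simp only [F']
      ring)
  refine key.2.congr_deriv ?_
  simp only [F', zero_smul, add_zero]
  rw [integral_sub ((integrable_mul_polyRieszKernel hfm hf hμ v _ hs hr hp1 hy).const_mul _)
    ((integrable_mul_polyRieszKernel hfm hf hμ v _ hs hr hp2 hy).const_mul _),
    integral_const_mul, integral_const_mul]

/-- If a potential vanishes near the origin, so does its derivative in direction `v`. -/
lemma integral_polyRieszKernel_recurrence (hfm : Measurable f)
    (hf : Integrable (fun z => f z * ‖z‖ ^ (-s)) μ) (hμ : ∀ᵐ z ∂μ, 2 * r ≤ ‖z‖)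
    (v : E) (m : ℕ) {p : ℝ} (hs : 0 ≤ s) (hr : 0 < r) (hp : s + m ≤ p)
    (h : ∀ y, ‖y‖ < r → ∫ z, f z * polyRieszKernel v m p (y - z) ∂μ = 0)
    {y : E} (hy : ‖y‖ < r) :
    m * ‖v‖ ^ 2 * ∫ z, f z * polyRieszKernel v (m - 1) p (y - z) ∂μ
      = p * ∫ z, f z * polyRieszKernel v (m + 1) (p + 2) (y - z) ∂μ := by
  have h1 := hasDerivAt_integral_polyRieszKernel hfm hf hμ v m hs hr hp hy
  have h2 : (fun t : ℝ => ∫ z, f z * polyRieszKernel v m p (y + t • v - z) ∂μ)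
      =ᶠ[𝓝 0] fun _ => 0 := by
    have : {t : ℝ | ‖y + t • v‖ < r} ∈ 𝓝 (0 : ℝ) := by
      apply (isOpen_lt (by fun_prop) continuous_const).mem_nhds
      simpa using hy
    filter_upwards [this] with t ht using h _ ht
  exact sub_eq_zero.1 (h1.unique ((hasDerivAt_const 0 0).congr_of_eventuallyEq h2))

/-- The Laplacian step: raising the exponent by two. -/
lemma integral_norm_rpow_add_two_eq_zero [FiniteDimensional ℝ E] (hfm : Measurable f)
    (hf : Integrable (fun z => f z * ‖z‖ ^ (-s)) μ) (hμ : ∀ᵐ z ∂μ, 2 * r ≤ ‖z‖)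
    {p : ℝ} (hs : 0 < s) (hr : 0 < r) (hp : s ≤ p) (hd : Module.finrank ℝ E < p + 2)
    (h : ∀ y, ‖y‖ < r → ∫ z, f z * polyRieszKernel 0 0 p (y - z) ∂μ = 0)
    {y : E} (hy : ‖y‖ < r) :
    ∫ z, f z * polyRieszKernel 0 0 (p + 2) (y - z) ∂μ = 0 := by
  have hv : ∀ (v w : E) q x, polyRieszKernel v 0 q x = polyRieszKernel w 0 q x := by
    simp [polyRieszKernel]
  have h1 : ∀ v y, ‖y‖ < r → ∫ z, f z * polyRieszKernel v 1 (p + 2) (y - z) ∂μ = 0 := by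
    intro v y hy
    have := integral_polyRieszKernel_recurrence hfm hf hμ v 0 hs.le hr (by simpa using hp)
      (fun y hy => by simpa only [hv v 0] using h y hy) hy
    have hp0 : p ≠ 0 := by linarith
    simpa [hp0] using this.symm
  have h2 : ∀ v, ‖v‖ ^ 2 * ∫ z, f z * polyRieszKernel 0 0 (p + 2) (y - z) ∂μ
      = (p + 2) * ∫ z, f z * polyRieszKernel v 2 (p + 2 + 2) (y - z) ∂μ := by
    intro v
    have := integral_polyRieszKernel_recurrence hfm hf hμ v 1 hs.le hr (by push_cast; linarith)
      (h1 v) hy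
    simpa [hv v 0] using this
  let b := stdOrthonormalBasis ℝ E
  have hint : ∀ v, Integrable (fun z => f z * polyRieszKernel v 2 (p + 2 + 2) (y - z)) μ :=
    fun v => integrable_mul_polyRieszKernel hfm hf hμ v 2 hs.le hr (by push_cast; linarith) hy
  have h3 : ∑ i, ∫ z, f z * polyRieszKernel (b i) 2 (p + 2 + 2) (y - z) ∂μ
      = ∫ z, f z * polyRieszKernel 0 0 (p + 2) (y - z) ∂μ := by
    rw [← integral_finsetSum _ fun i _ => hint (b i)]
    apply integral_congr_ae
    filter_upwards [hμ] with z hz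
    have hpos : 0 < ‖y - z‖ := hr.trans_le (half_norm_le_norm_sub hy hz).1
    have hsum : ∑ i, inner ℝ (b i) (y - z) ^ 2 = ‖y - z‖ ^ 2 := by
      simpa using b.sum_sq_norm_inner_right (y - z)
    rw [← Finset.mul_sum]
    congr 1
    simp only [polyRieszKernel, ← Finset.sum_mul, hsum]
    rw [← Real.rpow_natCast, ← Real.rpow_add hpos, pow_zero, one_mul]
    congr 1; push_cast; ring
  have h4 := Finset.sum_congr rfl fun i (_ : i ∈ Finset.univ) => h2 (b i)
  rw [← Finset.mul_sum, h3] at h4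
  simp only [b.norm_eq_one, one_pow, one_mul, Finset.sum_const, Finset.card_univ, Fintype.card_fin,
    nsmul_eq_mul] at h4
  have h5 : ((p + 2) - Module.finrank ℝ E) *
      ∫ z, f z * polyRieszKernel 0 0 (p + 2) (y - z) ∂μ = 0 := by linarith
  exact (mul_eq_zero.1 h5).resolve_left (by linarith)

lemma integral_polyRieszKernel_eq_zero [FiniteDimensional ℝ E] (hfm : Measurable f)
    (hf : Integrable (fun z => f z * ‖z‖ ^ (-s)) μ) (hμ : ∀ᵐ z ∂μ, 2 * r ≤ ‖z‖)
    (hs : 0 < s) (hr : 0 < r) (hd : Module.finrank ℝ E < s + 2)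
    (h : ∀ y, ‖y‖ < r → ∫ z, f z * ‖y - z‖ ^ (-s) ∂μ = 0) (v : E) (m : ℕ) :
    ∀ (k : ℕ) (y : E), ‖y‖ < r →
      ∫ z, f z * polyRieszKernel v m (s + 2 * k + 2 * m) (y - z) ∂μ = 0 := by
  have hv : ∀ q x, polyRieszKernel v 0 q x = polyRieszKernel 0 0 q x := by
    simp [polyRieszKernel]
  have hzero : ∀ (k : ℕ) (y : E), ‖y‖ < r →
      ∫ z, f z * polyRieszKernel v 0 (s + 2 * k) (y - z) ∂μ = 0 := by
    simp only [hv]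
    intro k
    induction k with
    | zero => simpa [polyRieszKernel] using h
    | succ k ih =>
      intro y hy
      have := integral_norm_rpow_add_two_eq_zero hfm hf hμ (p := s + 2 * k) hs hr
        (by linarith [k.cast_nonneg (α := ℝ)]) (by linarith [k.cast_nonneg (α := ℝ)]) ih hy
      rw [← this]
      push_cast
      ring_nf
  have hstep : ∀ m : ℕ, (∀ (k : ℕ) (y : E), ‖y‖ < r →
      ∫ z, f z * polyRieszKernel v m (s + 2 * k + 2 * m) (y - z) ∂μ = 0) →
      (∀ (k : ℕ) (y : E), ‖y‖ < r →
        m * ∫ z, f z * polyRieszKernel v (m - 1) (s + 2 * k + 2 * m) (y - z) ∂μ = 0) →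
      ∀ (k : ℕ) (y : E), ‖y‖ < r →
      ∫ z, f z * polyRieszKernel v (m + 1) (s + 2 * k + 2 * (m + 1 : ℕ)) (y - z) ∂μ = 0 := by
    intro m h1 h2 k y hy
    have hk := k.cast_nonneg (α := ℝ)
    have hm := m.cast_nonneg (α := ℝ)
    have := integral_polyRieszKernel_recurrence hfm hf hμ v m (p := s + 2 * k + 2 * m) hs.le hr
      (by linarith) (h1 k) hy
    rw [mul_right_comm, h2 k y hy, zero_mul] at this
    rw [show s + 2 * (k : ℝ) + 2 * ((m + 1 : ℕ) : ℝ) = s + 2 * k + 2 * m + 2 by push_cast; ring]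
    exact (mul_eq_zero.1 this.symm).resolve_left (by positivity)
  induction m using Nat.twoStepInduction with
  | zero => simpa using hzero
  | one => exact hstep 0 (by simpa using hzero) (by simp)
  | more m ih0 ih1 =>
    refine hstep (m + 1) ih1 fun k y hy => ?_
    have := ih0 (k + 1) y hy
    rw [show s + 2 * ((k + 1 : ℕ) : ℝ) + 2 * (m : ℝ) = s + 2 * k + 2 * (m + 1 : ℕ) by
      push_cast; ring] at this
    rw [Nat.add_sub_cancel, this, mul_zero]

end Integral

section Moments

variable {E : Type*} [NormedAddCommGroup E] [InnerProductSpace ℝ E] [MeasurableSpace E]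
  [BorelSpace E] [SecondCountableTopology E] {X : Type*} [MeasurableSpace X]
  {μ : Measure X} {g : X → ℝ} {W : X → E} {R : ℝ}

lemma integral_mul_cexp_inner_eq_zero (hg : Integrable g μ) (hW : Measurable W)
    (hWR : ∀ᵐ z ∂μ, ‖W z‖ ≤ R) (v : E)
    (h : ∀ m : ℕ, ∫ z, g z * inner ℝ (W z) v ^ m ∂μ = 0) :
    ∫ z, (g z : ℂ) * Complex.exp ((inner ℝ (W z) v : ℝ) * Complex.I) ∂μ = 0 := by
  have hexp : ∀ w : ℂ, HasSum (fun m : ℕ => w ^ m / (m.factorial : ℂ)) (Complex.exp w) := by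
    intro w
    rw [Complex.exp_eq_exp_ℂ]
    exact NormedSpace.expSeries_div_hasSum_exp w
  have hsum := hasSum_integral_of_dominated_convergence (μ := μ)
    (F := fun (m : ℕ) z => (g z : ℂ) *
      (((inner ℝ (W z) v : ℝ) * Complex.I) ^ m / (m.factorial : ℂ)))
    (f := fun z => (g z : ℂ) * Complex.exp ((inner ℝ (W z) v : ℝ) * Complex.I))
    (fun m z => ‖g z‖ * ((R * ‖v‖) ^ m / m.factorial))
    (fun m => hg.ofReal.aestronglyMeasurable.mul
      (Measurable.aestronglyMeasurable (by fun_prop)))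
    (fun m => by
      filter_upwards [hWR] with z hz
      rw [norm_mul, norm_div, norm_pow, norm_mul, Complex.norm_I, mul_one, Complex.norm_real,
        Complex.norm_real, Complex.norm_natCast]
      gcongr
      exact (norm_inner_le_norm _ _).trans (by gcongr))
    (Eventually.of_forall fun z => (Real.summable_pow_div_factorial _).mul_left _)
    (by simpa only [tsum_mul_left] using hg.norm.mul_const _)
    (Eventually.of_forall fun z => (hexp _).mul_left _)
  refine hsum.unique ?_
  have h0 : ∀ m : ℕ, ∫ z, (g z : ℂ) *
      (((inner ℝ (W z) v : ℝ) * Complex.I) ^ m / (m.factorial : ℂ)) ∂μ = 0 := by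
    intro m
    have hm : ∀ z, (g z : ℂ) * (((inner ℝ (W z) v : ℝ) * Complex.I) ^ m / (m.factorial : ℂ))
        = ((g z * inner ℝ (W z) v ^ m : ℝ) : ℂ) * (Complex.I ^ m / (m.factorial : ℂ)) := by
      intro z; push_cast; ring
    simp only [hm]
    rw [integral_mul_const, integral_complex_ofReal, h m, Complex.ofReal_zero, zero_mul]
  simp only [h0]
  exact hasSum_zero

/-- An integrable weight all of whose moments against a bounded injective map vanish is zero. -/
lemma ae_eq_zero_of_moments_eq_zero [CompleteSpace E] (hgm : Measurable g) (hg : Integrable g μ) (hW : Measurable W)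
    (hWR : ∀ᵐ z ∂μ, ‖W z‖ ≤ R) {W' : E → X} (hW' : Measurable W') (hinv : W' ∘ W = id)
    (h : ∀ (v : E) (m : ℕ), ∫ z, g z * inner ℝ (W z) v ^ m ∂μ = 0) :
    g =ᵐ[μ] 0 := by
  have hfin1 := isFiniteMeasure_withDensity_ofReal hg.hasFiniteIntegral
  have hfin2 := isFiniteMeasure_withDensity_ofReal hg.neg.hasFiniteIntegral
  have hm1 : Measurable fun z => ENNReal.ofReal (g z) := hgm.ennreal_ofReal
  have hm2 : Measurable fun z => ENNReal.ofReal ((-g) z) := hgm.neg.ennreal_ofReal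
  have hmap : (μ.withDensity fun z => ENNReal.ofReal (g z)).map W
      = (μ.withDensity fun z => ENNReal.ofReal ((-g) z)).map W := by
    apply Measure.ext_of_charFun
    ext v
    have hexp : Measurable fun z => Complex.exp ((inner ℝ (W z) v : ℝ) * Complex.I) := by fun_prop
    have hcf : ∀ u : X → ℝ, Measurable u → charFun ((μ.withDensity
        fun z => ENNReal.ofReal (u z)).map W) v =
        ∫ z, ((max (u z) 0 : ℝ) : ℂ) * Complex.exp ((inner ℝ (W z) v : ℝ) * Complex.I) ∂μ := by
      intro u hu
      rw [charFun_apply, integral_map hW.aemeasurable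
        (Measurable.aestronglyMeasurable (by fun_prop)),
        integral_withDensity_eq_integral_toReal_smul hu.ennreal_ofReal (by simp)]
      simp [ENNReal.toReal_ofReal']
    have hI : ∀ u : X → ℝ, Integrable u μ → Integrable (fun z => ((max (u z) 0 : ℝ) : ℂ) *
        Complex.exp ((inner ℝ (W z) v : ℝ) * Complex.I)) μ := by
      intro u hu
      refine hu.pos_part.ofReal.mul_bdd (c := 1) hexp.aestronglyMeasurable
        (Eventually.of_forall fun z => ?_)
      rw [Complex.norm_exp_ofReal_mul_I]
    rw [hcf g hgm, hcf (-g) hgm.neg, ← sub_eq_zero, ← integral_sub (hI g hg) (hI (-g) hg.neg),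
      ← integral_mul_cexp_inner_eq_zero hg hW hWR v (h v)]
    congr 1 with z
    rw [← sub_mul, ← Complex.ofReal_sub, Pi.neg_apply]
    congr 2
    exact max_zero_sub_eq_self (g z)
  have heq := congrArg (Measure.map W') hmap
  rw [Measure.map_map hW' hW, Measure.map_map hW' hW, hinv, Measure.map_id, Measure.map_id,
    withDensity_eq_iff hm1.aemeasurable hm2.aemeasurable] at heq
  · filter_upwards [heq] with z hz
    have := congrArg ENNReal.toReal hz
    simp only [ENNReal.toReal_ofReal', Pi.neg_apply] at this
    rcases le_total 0 (g z) with h0 | h0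
    · rw [max_eq_left h0, max_eq_right (by linarith)] at this
      exact this
    · rw [max_eq_right h0, max_eq_left (by linarith)] at this
      simp only [Pi.zero_apply]; linarith
  · exact ((lintegral_mono fun z => Real.ofReal_le_enorm (g z)).trans_lt hg.hasFiniteIntegral).ne

end Moments

section Uniqueness

variable {E : Type*} [NormedAddCommGroup E] [InnerProductSpace ℝ E] [FiniteDimensional ℝ E]
  [MeasurableSpace E] [BorelSpace E] {μ : Measure E} {f : E → ℝ} {s r : ℝ}

/-- Uniqueness for Riesz-type potentials: a density living away from the origin whose potential
with kernel `‖y - z‖ ^ (-s)` vanishes near the origin is zero. -/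
theorem ae_eq_zero_of_integral_norm_sub_rpow_eq_zero (hfm : Measurable f)
    (hf : Integrable (fun z => f z * ‖z‖ ^ (-s)) μ) (hμ : ∀ᵐ z ∂μ, 2 * r ≤ ‖z‖)
    (hs : 0 < s) (hr : 0 < r) (hd : Module.finrank ℝ E < s + 2)
    (h : ∀ y, ‖y‖ < r → ∫ z, f z * ‖y - z‖ ^ (-s) ∂μ = 0) : f =ᵐ[μ] 0 := by
  let W : E → E := fun z => (‖z‖ ^ 2)⁻¹ • z
  have hW : Measurable W := by fun_prop
  have hinv : W ∘ W = id := by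
    ext z
    rcases eq_or_ne z 0 with rfl | hz
    · simp [W]
    · have hz' : ‖z‖ ≠ 0 := norm_ne_zero_iff.2 hz
      simp only [W, Function.comp_apply, id, smul_smul, norm_smul, norm_inv, norm_pow, norm_norm]
      rw [show ((((‖z‖ ^ 2)⁻¹ * ‖z‖) ^ 2)⁻¹ * (‖z‖ ^ 2)⁻¹) = 1 by field_simp, one_smul]
  have hWR : ∀ᵐ z ∂μ, ‖W z‖ ≤ r⁻¹ := by
    filter_upwards [hμ] with z hz
    have hz' : 0 < ‖z‖ := by linarith
    have : ‖W z‖ = ‖z‖⁻¹ := by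
      simp only [W, norm_smul, norm_inv, norm_pow, norm_norm]
      field_simp
    rw [this]
    exact inv_anti₀ hr (by linarith)
  have hmom : ∀ (v : E) (m : ℕ), ∫ z, f z * ‖z‖ ^ (-s) * inner ℝ (W z) v ^ m ∂μ = 0 := by
    intro v m
    have := integral_polyRieszKernel_eq_zero hfm hf hμ hs hr hd h v m 0 0 (by simpa using hr)
    rw [← mul_zero ((-1 : ℝ) ^ m), ← this, ← integral_const_mul]
    apply integral_congr_ae
    filter_upwards [hμ] with z hz
    have hz' : 0 < ‖z‖ := by linarith
    have hpow : ‖z‖ ^ (-(s + 2 * ((0 : ℕ) : ℝ) + 2 * m)) = ‖z‖ ^ (-s) * ((‖z‖ ^ 2)⁻¹) ^ m := by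
      rw [inv_pow, ← pow_mul, ← Real.rpow_natCast, ← Real.rpow_neg hz'.le, ← Real.rpow_add hz']
      congr 1; push_cast; ring
    have hsign : (-1 : ℝ) ^ m * (-1) ^ m = 1 := by rw [← mul_pow]; simp
    simp only [W, polyRieszKernel, zero_sub, norm_neg, inner_neg_right, real_inner_smul_left, hpow]
    rw [neg_pow (inner ℝ v z), mul_pow, real_inner_comm v z]
    linear_combination (-(f z * ‖z‖ ^ (-s) * ((‖z‖ ^ 2)⁻¹) ^ m * inner ℝ v z ^ m)) * hsign
  have := ae_eq_zero_of_moments_eq_zero (hfm.mul (by fun_prop)) hf hW hWR hW hinv hmom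
  filter_upwards [this, hμ] with z h1 hz
  have hz' : 0 < ‖z‖ := by linarith
  exact (mul_eq_zero.1 h1).resolve_right (Real.rpow_pos_of_pos hz' _).ne'

end Uniqueness

/-- **Lemma 4.1.** Let `D` be a bounded Lipschitz domain in `ℝⁿ` (`n ≥ 2`) containing the
origin and `0 < α < 2`.  If `f` is measurable, vanishes on `D`, satisfies
`∫_{Dᶜ} |f(z)| |z|^{-(n+α)} dz < ∞`, and `∫_{Dᶜ} f(z)/|y-z|^{n+α} dz = 0` for all `y ∈ D`
(the integrals converging absolutely), then `f = 0` a.e. on `Dᶜ`. -/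
theorem stmt0 (n : ℕ) [NeZero n] (hn : 2 ≤ n) (α : ℝ) (hα : 0 < α) (hα2 : α < 2)
    (D : Set (EucSp n)) (hD : IsLipschitzDomain D) (h0 : (0 : EucSp n) ∈ D)
    (f : EucSp n → ℝ) (hfm : Measurable f) (hsupp : ∀ x ∈ D, f x = 0)
    (hint : IntegrableOn (fun z => |f z| * ‖z‖ ^ (-(n : ℝ) - α)) Dᶜ volume)
    (hint2 : ∀ y ∈ D, IntegrableOn (fun z => f z * ‖y - z‖ ^ (-(n : ℝ) - α)) Dᶜ volume)
    (hzero : ∀ y ∈ D, ∫ z in Dᶜ, f z * ‖y - z‖ ^ (-(n : ℝ) - α) = 0) :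
    ∀ᵐ z ∂(volume.restrict Dᶜ), f z = 0 := by
  have hDo : IsOpen D := hD.1.1
  obtain ⟨ε, hε, hball⟩ := Metric.isOpen_iff.1 hDo 0 h0
  have hexp : -(n : ℝ) - α = -((n : ℝ) + α) := by ring
  rw [hexp] at hint
  simp only [hexp] at hzero
  have hf : Integrable (fun z => f z * ‖z‖ ^ (-((n : ℝ) + α))) (volume.restrict Dᶜ) := by
    refine hint.mono' (hfm.mul (by fun_prop)).aestronglyMeasurable
      (Eventually.of_forall fun z => ?_)
    rw [norm_mul, Real.norm_eq_abs, Real.norm_of_nonneg (Real.rpow_nonneg (norm_nonneg z) _)]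
  have hfar : ∀ᵐ z ∂(volume.restrict Dᶜ), 2 * (ε / 2) ≤ ‖z‖ := by
    filter_upwards [ae_restrict_mem hDo.measurableSet.compl] with z hz
    by_contra! hlt
    exact hz (hball (mem_ball_zero_iff.2 (by linarith)))
  have hn0 : (0 : ℝ) ≤ n := n.cast_nonneg
  refine ae_eq_zero_of_integral_norm_sub_rpow_eq_zero hfm hf hfar (by linarith) (half_pos hε)
    ?_ fun y hy => hzero y (hball (mem_ball_zero_iff.2 (by linarith)))
  rw [finrank_euclideanSpace_fin]
  linarith
end
end

section
/- Let D be a bounded open set in R^n containing the origin, 0 < α < 2, and f a measurable function on D^c with ∫_{D^c} |f(z)| |z|^{-(n+α)} dz < ∞ satisfying ∫_{D^c} f(y)/|x-y|^{n+α} dy = 0 for all x ∈ D. Then for every nonnegative integer k, every 0 ≤ m ≤ k, and all indices i_1,…,i_m ∈ {1,…,n}, one has ∫_{D^c} (∏_{j=1}^m (x_{i_j} - y_{i_j})) |x-y|^{-(n+α+2k)} f(y) dy = 0 for all x ∈ D. -/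
open MeasureTheory Metric Filter Set Topology
open scoped ENNReal NNReal Topology

noncomputable section

variable {n : ℕ}

/-- `κ` is bounded by a multiple of `‖z‖ ^ (-s)` away from the origin. -/
def DecaysLike (s : ℝ) (κ : EucSp n → ℝ) : Prop :=
  ∀ ε : ℝ, 0 < ε → ∃ C, 0 ≤ C ∧ ∀ z, ε ≤ ‖z‖ → |κ z| ≤ C * ‖z‖ ^ (-s)

/-- The convolution of `κ` with `f` over `Dᶜ` vanishes on `D`. -/
def Annihilates (D : Set (EucSp n)) (f κ : EucSp n → ℝ) : Prop :=
  ∀ x ∈ D, ∫ y in Dᶜ, κ (x - y) * f y = 0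

/-- The kernel `∏_{j ∈ u} z_{idx j} · ‖z‖ ^ (-p)`. -/
def monomialKernel {ι : Type} (u : Finset ι) (idx : ι → Fin n) (p : ℝ) (z : EucSp n) : ℝ :=
  (∏ j ∈ u, z (idx j)) * ‖z‖ ^ (-p)

lemma DecaysLike.add {s : ℝ} {κ₁ κ₂ : EucSp n → ℝ} (h₁ : DecaysLike s κ₁)
    (h₂ : DecaysLike s κ₂) : DecaysLike s fun z => κ₁ z + κ₂ z := by
  intro ε hε
  obtain ⟨C₁, hC₁, hb₁⟩ := h₁ ε hε
  obtain ⟨C₂, hC₂, hb₂⟩ := h₂ ε hε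
  refine ⟨C₁ + C₂, by positivity, fun z hz => ?_⟩
  linarith [abs_add_le (κ₁ z) (κ₂ z), hb₁ z hz, hb₂ z hz, add_mul C₁ C₂ (‖z‖ ^ (-s))]

lemma DecaysLike.const_mul {s : ℝ} {κ : EucSp n → ℝ} (h : DecaysLike s κ) (c : ℝ) :
    DecaysLike s fun z => c * κ z := by
  intro ε hε
  obtain ⟨C, hC, hb⟩ := h ε hε
  refine ⟨|c| * C, by positivity, fun z hz => ?_⟩
  rw [abs_mul, mul_assoc]
  exact mul_le_mul_of_nonneg_left (hb z hz) (abs_nonneg c)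

lemma DecaysLike.sum {ι : Type} {s : ℝ} {κ : ι → EucSp n → ℝ} (u : Finset ι)
    (h : ∀ j ∈ u, DecaysLike s (κ j)) : DecaysLike s fun z => ∑ j ∈ u, κ j z := by
  classical
  induction u using Finset.induction_on with
  | empty =>
    intro ε hε
    exact ⟨0, le_rfl, fun z hz => by simp⟩
  | insert a u ha ih =>
    simp only [Finset.sum_insert ha]
    exact (h a (by simp)).add (ih fun j hj => h j (by simp [hj]))

lemma exists_forall_notMem_le_norm_sub {D : Set (EucSp n)} (hD : IsOpen D) {x : EucSp n}
    (hx : x ∈ D) : ∃ ε : ℝ, 0 < ε ∧ ∀ y ∉ D, ε ≤ ‖x - y‖ := by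
  obtain ⟨ε, hε, hb⟩ := Metric.isOpen_iff.1 hD x hx
  refine ⟨ε, hε, fun y hy => ?_⟩
  by_contra! h
  exact hy (hb (by rwa [mem_ball, dist_comm, dist_eq_norm]))

lemma DecaysLike.integrableOn {s : ℝ} {κ f : EucSp n → ℝ} (h : DecaysLike s κ)
    (hκ : Measurable κ) (hf : Measurable f) {D : Set (EucSp n)} (hD : IsOpen D)
    {x : EucSp n} (hx : x ∈ D)
    (hint : IntegrableOn (fun y => f y * ‖x - y‖ ^ (-s)) Dᶜ volume) :
    IntegrableOn (fun y => κ (x - y) * f y) Dᶜ volume := by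
  obtain ⟨ε, hε, hb⟩ := exists_forall_notMem_le_norm_sub hD hx
  obtain ⟨C, hC, hκC⟩ := h ε hε
  refine Integrable.mono' (hint.norm.const_mul C) (by fun_prop) ?_
  filter_upwards [ae_restrict_mem hD.measurableSet.compl] with y hy
  have h1 := mul_le_mul_of_nonneg_right (hκC _ (hb y hy)) (abs_nonneg (f y))
  have h2 : 0 ≤ ‖x - y‖ ^ (-s) := by positivity
  rw [Real.norm_eq_abs, Real.norm_eq_abs, abs_mul, abs_mul, abs_of_nonneg h2]
  linarith

lemma Annihilates.of_hasDerivAt {s : ℝ} (hs : 0 ≤ s) {κ κ' f : EucSp n → ℝ} {v : EucSp n}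
    (hv : ‖v‖ ≤ 1) {D : Set (EucSp n)} (hD : IsOpen D) (hκ : Measurable κ) (hκ' : Measurable κ')
    (hf : Measurable f) (hb : DecaysLike s κ) (hb' : DecaysLike s κ')
    (hderiv : ∀ z t, z + t • v ≠ 0 →
      HasDerivAt (fun τ : ℝ => κ (z + τ • v)) (κ' (z + t • v)) t)
    (hint : ∀ x ∈ D, IntegrableOn (fun y => f y * ‖x - y‖ ^ (-s)) Dᶜ volume)
    (h : Annihilates D f κ) : Annihilates D f κ' := by
  intro x hx
  obtain ⟨δ, hδ, hδD⟩ := exists_forall_notMem_le_norm_sub hD hx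
  obtain ⟨C, hC, hκC⟩ := hb' (δ / 2) (by positivity)
  have hnorm : ∀ y ∉ D, ∀ t ∈ ball (0 : ℝ) (δ / 2), ‖x - y‖ / 2 ≤ ‖x - y + t • v‖ := by
    intro y hy t ht
    have h1 := norm_sub_le (x - y + t • v) (t • v)
    rw [add_sub_cancel_right, norm_smul] at h1
    rw [mem_ball_zero_iff] at ht
    nlinarith [hδD y hy, norm_nonneg t, norm_nonneg v]
  have hshift : ∀ (t : ℝ) (y : EucSp n), x - y + t • v = x + t • v - y := fun t y => by abel
  have key := (hasDerivAt_integral_of_dominated_loc_of_deriv_le (μ := volume.restrict Dᶜ)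
    (F := fun (t : ℝ) y => κ (x - y + t • v) * f y)
    (F' := fun (t : ℝ) y => κ' (x - y + t • v) * f y) (x₀ := 0)
    (bound := fun y => C * 2 ^ s * ‖f y * ‖x - y‖ ^ (-s)‖)
    (ball_mem_nhds (0 : ℝ) (half_pos hδ)) (Eventually.of_forall fun t => by fun_prop)
    (by simpa [IntegrableOn] using hb.integrableOn hκ hf hD hx (hint x hx)) (by fun_prop) ?_
    ((hint x hx).norm.const_mul _) ?_).2
  · have hzero : (fun t : ℝ => ∫ y in Dᶜ, κ (x - y + t • v) * f y) =ᶠ[𝓝 0] fun _ => 0 := by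
      have hmem : ∀ᶠ t : ℝ in 𝓝 0, x + t • v ∈ D := by
        have hc : ContinuousAt (fun t : ℝ => x + t • v) 0 := by fun_prop
        exact hc.eventually_mem (hD.mem_nhds (by simpa using hx))
      filter_upwards [hmem] with t ht
      simp only [hshift]
      exact h _ ht
    simpa using (key.congr_of_eventuallyEq hzero.symm).unique (hasDerivAt_const (0 : ℝ) (0 : ℝ))
  · filter_upwards [ae_restrict_mem hD.measurableSet.compl] with y hy t ht
    have h1 := hnorm y hy t ht
    have h2 := hδD y hy
    have h3 : ‖x - y + t • v‖ ^ (-s) ≤ 2 ^ s * ‖x - y‖ ^ (-s) := by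
      calc ‖x - y + t • v‖ ^ (-s) ≤ (‖x - y‖ / 2) ^ (-s) :=
            Real.rpow_le_rpow_of_nonpos (by linarith) h1 (by linarith)
        _ = 2 ^ s * ‖x - y‖ ^ (-s) := by
            rw [Real.div_rpow (norm_nonneg _) (by norm_num), Real.rpow_neg (x := 2) (by norm_num)]
            field_simp
    have h4 : |κ' (x - y + t • v)| ≤ C * (2 ^ s * ‖x - y‖ ^ (-s)) :=
      (hκC _ (by linarith)).trans (mul_le_mul_of_nonneg_left h3 hC)
    have h5 : 0 ≤ ‖x - y‖ ^ (-s) := by positivity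
    have h6 := mul_le_mul_of_nonneg_right h4 (abs_nonneg (f y))
    rw [Real.norm_eq_abs, Real.norm_eq_abs, abs_mul, abs_mul, abs_of_nonneg h5]
    linarith
  · filter_upwards [ae_restrict_mem hD.measurableSet.compl] with y hy t ht
    have h1 := hnorm y hy t ht
    have h2 := hδD y hy
    exact (hderiv _ _ (norm_pos_iff.1 (by linarith))).mul_const _

lemma measurable_monomialKernel {ι : Type} (u : Finset ι) (idx : ι → Fin n) (p : ℝ) :
    Measurable (monomialKernel u idx p) := by
  unfold monomialKernel
  fun_prop

lemma decaysLike_monomialKernel {ι : Type} {s p : ℝ} (u : Finset ι) (idx : ι → Fin n)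
    (h : s + u.card ≤ p) : DecaysLike s (monomialKernel u idx p) := by
  intro ε hε
  refine ⟨ε ^ (s + u.card - p), by positivity, fun z hz => ?_⟩
  have hz0 : 0 < ‖z‖ := hε.trans_le hz
  have h1 : |∏ j ∈ u, z (idx j)| ≤ ‖z‖ ^ u.card := by
    rw [Finset.abs_prod, ← Finset.prod_const]
    exact Finset.prod_le_prod (fun j _ => abs_nonneg _) fun j _ => PiLp.norm_apply_le z (idx j)
  have h2 : 0 ≤ ‖z‖ ^ (-p) := by positivity
  calc |monomialKernel u idx p z| = |∏ j ∈ u, z (idx j)| * ‖z‖ ^ (-p) := by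
        rw [monomialKernel, abs_mul, abs_of_nonneg h2]
    _ ≤ ‖z‖ ^ u.card * ‖z‖ ^ (-p) := mul_le_mul_of_nonneg_right h1 h2
    _ = ‖z‖ ^ (s + u.card - p) * ‖z‖ ^ (-s) := by
        rw [← Real.rpow_natCast, ← Real.rpow_add hz0, ← Real.rpow_add hz0]
        ring_nf
    _ ≤ ε ^ (s + u.card - p) * ‖z‖ ^ (-s) := by
        exact mul_le_mul_of_nonneg_right (Real.rpow_le_rpow_of_nonpos hε hz (by linarith))
          (by positivity)

lemma hasDerivAt_norm_add_smul_rpow {z v : EucSp n} {t : ℝ} (h : z + t • v ≠ 0) (q : ℝ) :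
    HasDerivAt (fun τ : ℝ => ‖z + τ • v‖ ^ q)
      (q * inner ℝ (z + t • v) v * ‖z + t • v‖ ^ (q - 2)) t := by
  have h0 : 0 < ‖z + t • v‖ := norm_pos_iff.2 h
  have h1 : HasDerivAt (fun τ : ℝ => z + τ • v) v t := by
    simpa using ((hasDerivAt_id t).smul_const v).const_add z
  have h2 := h1.norm_sq.rpow_const (p := q / 2) (Or.inl (by positivity))
  have hpow : ∀ (w : EucSp n) (r : ℝ), (‖w‖ ^ 2) ^ r = ‖w‖ ^ (2 * r) := fun w r => by
    rw [← Real.rpow_natCast, ← Real.rpow_mul (norm_nonneg w)]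
    norm_num
  simp only [hpow] at h2
  convert h2 using 1
  · ext τ
    ring_nf
  · ring_nf

/-- The partial derivative of `monomialKernel u idx p` in the `i`-th coordinate. -/
def monomialKernelDeriv {ι : Type} [DecidableEq ι] (u : Finset ι) (idx : ι → Fin n) (p : ℝ)
    (i : Fin n) (z : EucSp n) : ℝ :=
  (∑ j ∈ u, (if idx j = i then 1 else 0) * monomialKernel (u.erase j) idx p z) +
    -p * monomialKernel (Finset.insertNone u) (fun j => j.elim i idx) (p + 2) z

lemma hasDerivAt_monomialKernel {ι : Type} [DecidableEq ι] (u : Finset ι) (idx : ι → Fin n)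
    (p : ℝ) (i : Fin n) (z : EucSp n) (t : ℝ) (h : z + t • EuclideanSpace.single i (1 : ℝ) ≠ 0) :
    HasDerivAt (fun τ : ℝ => monomialKernel u idx p (z + τ • EuclideanSpace.single i (1 : ℝ)))
      (monomialKernelDeriv u idx p i (z + t • EuclideanSpace.single i (1 : ℝ))) t := by
  have hcoord : ∀ j ∈ u, HasDerivAt
      (fun τ : ℝ => (z + τ • EuclideanSpace.single i (1 : ℝ)) (idx j))
      (if idx j = i then 1 else 0) t := fun j _ => by
    simpa [Pi.single_apply] using
      ((hasDerivAt_id t).mul_const (if idx j = i then (1 : ℝ) else 0)).const_add (z (idx j))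
  have h1 := (HasDerivAt.fun_finsetProd hcoord).mul (hasDerivAt_norm_add_smul_rpow h (-p))
  unfold monomialKernelDeriv monomialKernel
  refine h1.congr_deriv ?_
  simp only [smul_eq_mul, Finset.sum_mul, Finset.prod_insertNone, Option.elim]
  congr 1
  · exact Finset.sum_congr rfl fun j _ => by ring
  · rw [EuclideanSpace.inner_single_right, show -p - 2 = -(p + 2) by ring]
    simp
    ring

lemma measurable_monomialKernelDeriv {ι : Type} [DecidableEq ι] (u : Finset ι)
    (idx : ι → Fin n) (p : ℝ) (i : Fin n) : Measurable (monomialKernelDeriv u idx p i) := by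
  unfold monomialKernelDeriv
  have := fun (v : Finset ι) => measurable_monomialKernel v idx p
  have := measurable_monomialKernel (Finset.insertNone u) (fun j => j.elim i idx) (p + 2)
  fun_prop

lemma decaysLike_monomialKernelDeriv {ι : Type} [DecidableEq ι] {s p : ℝ} {u : Finset ι}
    (h : s + u.card ≤ p) (idx : ι → Fin n) (i : Fin n) :
    DecaysLike s (monomialKernelDeriv u idx p i) := by
  refine .add (.sum u fun j _ => .const_mul (decaysLike_monomialKernel _ _ ?_) _)
    (.const_mul (decaysLike_monomialKernel _ _ ?_) _)
  · have : ((u.erase j).card : ℝ) ≤ u.card := mod_cast Finset.card_erase_le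
    linarith
  · rw [Finset.card_insertNone]
    push_cast
    linarith

section Induction

variable {ι : Type} {s p : ℝ} {D : Set (EucSp n)} {f : EucSp n → ℝ}

lemma Annihilates.monomialKernelDeriv [DecidableEq ι] {u : Finset ι} {idx : ι → Fin n}
    (h : Annihilates D f (monomialKernel u idx p)) (hs : 0 ≤ s) (hp : s + u.card ≤ p)
    (hD : IsOpen D) (hf : Measurable f)
    (hint : ∀ x ∈ D, IntegrableOn (fun y => f y * ‖x - y‖ ^ (-s)) Dᶜ volume) (i : Fin n) :
    Annihilates D f (monomialKernelDeriv u idx p i) :=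
  .of_hasDerivAt hs (v := EuclideanSpace.single i 1) (by simp) hD
    (measurable_monomialKernel u idx p) (measurable_monomialKernelDeriv u idx p i) hf
    (decaysLike_monomialKernel u idx hp) (decaysLike_monomialKernelDeriv hp idx i)
    (hasDerivAt_monomialKernel u idx p i) hint h

lemma Annihilates.monomialKernel_insertNone [DecidableEq ι] {u : Finset ι} {idx : ι → Fin n}
    (h : Annihilates D f (monomialKernel u idx p))
    (herase : ∀ j ∈ u, Annihilates D f (monomialKernel (u.erase j) idx p))
    (hs : 0 < s) (hp : s + u.card ≤ p) (hD : IsOpen D) (hf : Measurable f)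
    (hint : ∀ x ∈ D, IntegrableOn (fun y => f y * ‖x - y‖ ^ (-s)) Dᶜ volume) (i : Fin n) :
    Annihilates D f
      (monomialKernel (Finset.insertNone u) (fun j => j.elim i idx) (p + 2)) := by
  intro x hx
  have hp0 : 0 < p := by
    have : (0 : ℝ) ≤ u.card := by positivity
    linarith
  have hI : ∀ j ∈ u, IntegrableOn
      (fun y => monomialKernel (u.erase j) idx p (x - y) * f y) Dᶜ volume := fun j _ => by
    refine (decaysLike_monomialKernel _ _ ?_).integrableOn
      (measurable_monomialKernel _ _ _) hf hD hx (hint x hx)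
    have : ((u.erase j).card : ℝ) ≤ u.card := mod_cast Finset.card_erase_le
    linarith
  have hI' : IntegrableOn (fun y => monomialKernel (Finset.insertNone u)
      (fun j => j.elim i idx) (p + 2) (x - y) * f y) Dᶜ volume := by
    refine (decaysLike_monomialKernel _ _ ?_).integrableOn
      (measurable_monomialKernel _ _ _) hf hD hx (hint x hx)
    rw [Finset.card_insertNone]
    push_cast
    linarith
  have key := h.monomialKernelDeriv hs.le hp hD hf hint i x hx
  simp only [_root_.monomialKernelDeriv, add_mul, Finset.sum_mul, mul_assoc] at key
  rw [integral_add (integrable_finsetSum _ fun j hj => (hI j hj).const_mul _) (hI'.const_mul _),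
    integral_finsetSum _ fun j hj => (hI j hj).const_mul _, integral_const_mul,
    Finset.sum_eq_zero fun j hj => by rw [integral_const_mul, herase j hj x hx, mul_zero],
    zero_add] at key
  exact (mul_eq_zero.1 key).resolve_left (by linarith)

/-- The divergence identity `∑ᵢ ∂ᵢ (zᵢ ‖z‖ ^ (-p)) = (n - p) ‖z‖ ^ (-p)`. -/
lemma sum_monomialKernelDeriv_singleton (idx : ι → Fin n) {z : EucSp n} (hz : z ≠ 0) :
    ∑ i, _root_.monomialKernelDeriv {()} (fun _ => i) p i z =
      (n - p) * monomialKernel ∅ idx p z := by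
  have hz0 : 0 < ‖z‖ := norm_pos_iff.2 hz
  have h1 : ‖z‖ ^ (-(p + 2)) * ‖z‖ ^ 2 = ‖z‖ ^ (-p) := by
    rw [← Real.rpow_natCast, ← Real.rpow_add hz0]
    norm_num
  simp only [_root_.monomialKernelDeriv, monomialKernel, Finset.prod_insertNone, Option.elim,
    Finset.card_singleton, Nat.cast_one, Finset.prod_singleton, if_true, Finset.erase_singleton,
    Finset.prod_empty, one_mul, Finset.sum_add_distrib, Finset.sum_const, Finset.card_univ,
    Fintype.card_fin, nsmul_eq_mul, ← Finset.mul_sum, ← Finset.sum_mul]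
  rw [← h1, EuclideanSpace.real_norm_sq_eq]
  simp only [pow_two]
  ring

lemma Annihilates.monomialKernel_empty (idx : ι → Fin n)
    (h : ∀ i, Annihilates D f (monomialKernel {()} (fun _ => i) p)) (hpn : p ≠ n)
    (hs : 0 ≤ s) (hp : s + 1 ≤ p) (hD : IsOpen D) (hf : Measurable f)
    (hint : ∀ x ∈ D, IntegrableOn (fun y => f y * ‖x - y‖ ^ (-s)) Dᶜ volume) :
    Annihilates D f (monomialKernel ∅ idx p) := by
  intro x hx
  have hp' : s + ({()} : Finset Unit).card ≤ p := by simpa using hp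
  have h1 : ∫ y in Dᶜ, ∑ i, _root_.monomialKernelDeriv {()} (fun _ => i) p i (x - y) * f y = 0 := by
    rw [integral_finsetSum _ fun i _ => (decaysLike_monomialKernelDeriv hp' _ i).integrableOn
      (measurable_monomialKernelDeriv _ _ p i) hf hD hx (hint x hx)]
    exact Finset.sum_eq_zero fun i _ => (h i).monomialKernelDeriv hs hp' hD hf hint i x hx
  have h2 : ∫ y in Dᶜ, ∑ i, _root_.monomialKernelDeriv {()} (fun _ => i) p i (x - y) * f y =
      ∫ y in Dᶜ, (n - p) * (monomialKernel ∅ idx p (x - y) * f y) := by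
    refine setIntegral_congr_fun hD.measurableSet.compl fun y hy => ?_
    have hxy : x - y ≠ 0 := sub_ne_zero.2 fun e => hy (e ▸ hx)
    simp only [← Finset.sum_mul, sum_monomialKernelDeriv_singleton idx hxy, mul_assoc]
  rw [h2, integral_const_mul] at h1
  exact (mul_eq_zero.1 h1).resolve_left (sub_ne_zero.2 hpn.symm)

lemma annihilates_monomialKernel (hs : (n : ℝ) < s) (hD : IsOpen D) (hf : Measurable f)
    (hint : ∀ x ∈ D, IntegrableOn (fun y => f y * ‖x - y‖ ^ (-s)) Dᶜ volume)
    (hzero : ∀ x ∈ D, ∫ y in Dᶜ, f y * ‖x - y‖ ^ (-s) = 0) (k : ℕ) :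
    ∀ {ι : Type} [DecidableEq ι] (u : Finset ι) (idx : ι → Fin n), u.card ≤ k →
      Annihilates D f (monomialKernel u idx (s + 2 * k)) := by
  have hs0 : 0 < s := (Nat.cast_nonneg n).trans_lt hs
  induction k with
  | zero =>
    intro ι _ u idx hu x hx
    obtain rfl : u = ∅ := by simpa using hu
    simpa [monomialKernel, mul_comm] using hzero x hx
  | succ k ih =>
    have hexp : s + 2 * ((k + 1 : ℕ) : ℝ) = s + 2 * k + 2 := by
      push_cast
      ring
    have hnonempty : ∀ {ι : Type} [DecidableEq ι] (u : Finset ι) (idx : ι → Fin n),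
        u.Nonempty → u.card ≤ k + 1 →
        Annihilates D f (monomialKernel u idx (s + 2 * k + 2)) := by
      intro ι _ u idx ⟨a, ha⟩ hu
      have hcard : (u.erase a).card ≤ k := by
        rw [Finset.card_erase_of_mem ha]
        omega
      have hcard' : ((u.erase a).card : ℝ) ≤ k := mod_cast hcard
      have h1 := (ih (u.erase a) idx hcard).monomialKernel_insertNone
        (fun j _ => ih _ idx (Finset.card_erase_le.trans hcard)) hs0
        (by linarith [(Nat.cast_nonneg k : (0 : ℝ) ≤ k)]) hD hf hint (idx a)
      have h2 : monomialKernel (Finset.insertNone (u.erase a)) (fun j => j.elim (idx a) idx)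
          (s + 2 * k + 2) = monomialKernel u idx (s + 2 * k + 2) := by
        funext z
        simp only [monomialKernel, Finset.prod_insertNone, Option.elim]
        rw [Finset.mul_prod_erase u (fun j => z (idx j)) ha]
      rwa [h2] at h1
    intro ι _ u idx hu
    rw [hexp]
    have hk : (0 : ℝ) ≤ k := Nat.cast_nonneg k
    rcases u.eq_empty_or_nonempty with rfl | hne
    · exact .monomialKernel_empty idx (fun i => hnonempty {()} _ (by simp) (by simp))
        (by linarith : (n : ℝ) < s + 2 * k + 2).ne' hs0.le (by linarith) hD hf hint
    · exact hnonempty u idx hne hu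

end Induction

/-- The inductive claim in the proof of Lemma 4.1: if `D ⊆ ℝⁿ` is bounded open with
`0 ∈ D`, `0 < α < 2`, `f` is measurable on `Dᶜ` with `∫_{Dᶜ}|f(z)||z|^{-(n+α)}dz < ∞` and
`∫_{Dᶜ} f(y)/|x-y|^{n+α} dy = 0` for all `x ∈ D`, then for all `k`, all `0 ≤ m ≤ k` and all
indices `i₁,…,i_m`, `∫_{Dᶜ} (∏_j (x_{i_j}-y_{i_j})) |x-y|^{-(n+α+2k)} f(y) dy = 0` for all
`x ∈ D` (the integrals converging absolutely). -/
theorem stmt1 (n : ℕ) (hn : 2 ≤ n) (α : ℝ) (hα : 0 < α) (hα2 : α < 2)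
    (D : Set (EucSp n)) (hDo : IsOpen D) (hDb : Bornology.IsBounded D)
    (h0 : (0 : EucSp n) ∈ D)
    (f : EucSp n → ℝ) (hfm : Measurable f)
    (hint : IntegrableOn (fun z => |f z| * ‖z‖ ^ (-(n : ℝ) - α)) Dᶜ volume)
    (hint2 : ∀ x ∈ D, IntegrableOn (fun y => f y * ‖x - y‖ ^ (-(n : ℝ) - α)) Dᶜ volume)
    (hzero : ∀ x ∈ D, ∫ y in Dᶜ, f y * ‖x - y‖ ^ (-(n : ℝ) - α) = 0) :
    ∀ (k m : ℕ), m ≤ k → ∀ idx : Fin m → Fin n, ∀ x ∈ D,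
      IntegrableOn
        (fun y => (∏ j : Fin m, (x (idx j) - y (idx j))) *
          ‖x - y‖ ^ (-((n : ℝ) + α + 2 * k)) * f y) Dᶜ volume ∧
      ∫ y in Dᶜ, (∏ j : Fin m, (x (idx j) - y (idx j))) *
          ‖x - y‖ ^ (-((n : ℝ) + α + 2 * k)) * f y = 0 := by
  intro k m hmk idx x hx
  have hs : -(n : ℝ) - α = -((n : ℝ) + α) := by ring
  rw [hs] at hint2 hzero
  refine ⟨?_, ?_⟩
  · have hm : (m : ℝ) ≤ k := mod_cast hmk
    exact (decaysLike_monomialKernel Finset.univ idx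
      (by rw [Finset.card_univ, Fintype.card_fin]; linarith [(Nat.cast_nonneg k : (0 : ℝ) ≤ k)])
      ).integrableOn (measurable_monomialKernel _ _ _) hfm hDo hx (hint2 x hx)
  · exact annihilates_monomialKernel (by linarith) hDo hfm hint2 hzero k Finset.univ idx
      (by simpa using hmk) x hx
end
end

section
/- Let D^c be the complement of a bounded open set D in R^n with 0 ∈ D, so that D^c is a closed set bounded away from the origin. The linear span of the family of functions y ↦ y^β |y|^{-2k}, where k ranges over nonnegative integers and β over multi-indices with |β| ≤ k, is dense in the space C_∞(D^c) of continuous functions on D^c vanishing at infinity, with respect to the uniform norm. -/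
open MeasureTheory Metric Filter Set Topology
open scoped ENNReal NNReal Topology

noncomputable section

variable {n : ℕ}

/-- Polynomials in the coordinates are uniformly dense in the continuous functions on a compact
subset of Euclidean space. -/
theorem exists_mvPolynomial_near_of_isCompact {ι : Type*} [Fintype ι]
    {K : Set (EuclideanSpace ℝ ι)} (hK : IsCompact K) {f : EuclideanSpace ℝ ι → ℝ}
    (hf : ContinuousOn f K) {ε : ℝ} (hε : 0 < ε) :
    ∃ p : MvPolynomial ι ℝ, ∀ z ∈ K, |MvPolynomial.eval (fun j => z j) p - f z| < ε := by
  have : CompactSpace K := isCompact_iff_compactSpace.mp hK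
  let coord : ι → C(K, ℝ) := fun j => ⟨fun z => z.1 j, by fun_prop⟩
  have hsep : (MvPolynomial.aeval coord : MvPolynomial ι ℝ →ₐ[ℝ] C(K, ℝ)).range.SeparatesPoints := by
    intro x y hxy
    obtain ⟨j, hj⟩ : ∃ j, x.1 j ≠ y.1 j := by
      by_contra! h
      exact hxy (Subtype.ext (PiLp.ext h))
    exact ⟨coord j, ⟨coord j, ⟨MvPolynomial.X j, by simp⟩, rfl⟩, hj⟩
  obtain ⟨⟨_, p, rfl⟩, hp⟩ :=
    ContinuousMap.exists_mem_subalgebra_near_continuous_of_separatesPoints _ hsep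
      (K.domRestrict f) hf.domRestrict ε hε
  refine ⟨p, fun z hz => ?_⟩
  have heval : (MvPolynomial.aeval coord p) ⟨z, hz⟩ = MvPolynomial.eval (fun j => z j) p := by
    clear hp
    induction p using MvPolynomial.induction_on with
    | C a => simp
    | add p q hp hq => simp_all
    | mul_X p j hp => simp_all [coord]
  simpa [heval] using hp ⟨z, hz⟩

section Inversion

variable {E : Type*} [NormedAddCommGroup E] [NormedSpace ℝ E]

/-- Inversion in the unit sphere centred at the origin (the origin is sent to itself). -/
def sphereInv (y : E) : E := (‖y‖ ^ 2)⁻¹ • y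

@[simp]
theorem sphereInv_zero : sphereInv (0 : E) = 0 := by simp [sphereInv]

theorem norm_sphereInv (y : E) : ‖sphereInv y‖ = ‖y‖⁻¹ := by
  rcases eq_or_ne y 0 with rfl | hy
  · simp
  · have : ‖y‖ ≠ 0 := norm_ne_zero_iff.mpr hy
    rw [sphereInv, norm_smul, norm_inv, norm_pow, norm_norm]
    field_simp

@[simp]
theorem sphereInv_eq_zero {y : E} : sphereInv y = 0 ↔ y = 0 := by
  rw [← norm_eq_zero, norm_sphereInv, inv_eq_zero, norm_eq_zero]

@[simp]
theorem sphereInv_sphereInv (y : E) : sphereInv (sphereInv y) = y := by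
  rcases eq_or_ne y 0 with rfl | hy
  · simp
  · have : ‖y‖ ≠ 0 := norm_ne_zero_iff.mpr hy
    rw [sphereInv, norm_sphereInv, sphereInv, smul_smul]
    field_simp
    simp

theorem continuousAt_sphereInv {y : E} (hy : y ≠ 0) : ContinuousAt (sphereInv : E → E) y := by
  have : ‖y‖ ^ 2 ≠ 0 := pow_ne_zero 2 (norm_ne_zero_iff.mpr hy)
  unfold sphereInv
  fun_prop (disch := assumption)

theorem tendsto_sphereInv_nhdsNE_zero :
    Tendsto (sphereInv : E → E) (𝓝[≠] 0) (Bornology.cobounded E) := by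
  rw [← tendsto_norm_atTop_iff_cobounded]
  simp_rw [norm_sphereInv]
  exact tendsto_norm_nhdsNE_zero.inv_tendsto_nhdsGT_zero

/-- The inverted image of the complement of an open neighbourhood of the origin, with the
origin added, is compact. -/
theorem isCompact_insert_zero_sphereInv_preimage_compl [ProperSpace E] {D : Set E}
    (hDo : IsOpen D) (h0 : (0 : E) ∈ D) :
    IsCompact (insert 0 (sphereInv ⁻¹' Dᶜ)) := by
  refine Metric.isCompact_of_isClosed_isBounded ?_ ?_
  · rw [← isOpen_compl_iff, isOpen_iff_mem_nhds]
    intro z hz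
    simp only [mem_compl_iff, mem_insert_iff, mem_preimage, not_or, not_not] at hz
    filter_upwards [isOpen_ne.mem_nhds hz.1,
      (continuousAt_sphereInv hz.1).preimage_mem_nhds (hDo.mem_nhds hz.2)] with w hw hw'
    simpa using ⟨hw, hw'⟩
  · obtain ⟨r, hr, hrD⟩ := Metric.isOpen_iff.mp hDo 0 h0
    refine isBounded_iff_forall_norm_le.mpr ⟨r⁻¹, ?_⟩
    rintro z (rfl | hz)
    · simpa using hr.le
    · have : r ≤ ‖sphereInv z‖ := by
        by_contra! h
        exact hz (hrD (by simpa using h))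
      rw [← sphereInv_sphereInv z, norm_sphereInv]
      exact inv_anti₀ hr this

/-- A function that is continuous on the complement of a set, and vanishes
at infinity there, becomes continuous at the origin after inversion. -/
theorem continuousOn_update_comp_sphereInv [ProperSpace E] [DecidableEq E] {D : Set E} {g : E → ℝ}
    (hg : ContinuousOn g Dᶜ) (hg0 : Tendsto g (cocompact E ⊓ 𝓟 Dᶜ) (𝓝 0)) :
    ContinuousOn (Function.update (g ∘ sphereInv) 0 0) (insert 0 (sphereInv ⁻¹' Dᶜ)) := by
  intro z hz
  rcases eq_or_ne z 0 with rfl | hz0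
  · rw [continuousWithinAt_update_same]
    refine hg0.comp (tendsto_inf.mpr ⟨?_, ?_⟩)
    · rw [← Metric.cobounded_eq_cocompact]
      exact tendsto_sphereInv_nhdsNE_zero.mono_left (nhdsWithin_mono _ fun z hz => hz.2)
    · refine tendsto_principal.mpr (eventually_mem_nhdsWithin.mono ?_)
      rintro z ⟨hz | hz, hz'⟩
      · exact absurd hz hz'
      · exact hz
  · rw [continuousWithinAt_update_of_ne hz0, continuousWithinAt_insert]
    have hzD : sphereInv z ∈ Dᶜ := hz.resolve_left hz0
    exact (hg _ hzD).comp (continuousAt_sphereInv hz0).continuousWithinAt fun _ h => h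

end Inversion

/-- **Stone–Weierstrass step of Lemma 4.1.** Let `D ⊆ ℝⁿ` be bounded open with `0 ∈ D`, so
`Dᶜ` is closed and bounded away from the origin.  The linear span of the functions
`y ↦ y^β |y|^{-2k}` (`k ∈ ℕ`, `β` a multi-index with `|β| ≤ k`) is uniformly dense in the
space of continuous functions on `Dᶜ` vanishing at infinity. -/
theorem stmt2 (n : ℕ) (hn : 2 ≤ n)
    (D : Set (EucSp n)) (hDo : IsOpen D) (hDb : Bornology.IsBounded D)
    (h0 : (0 : EucSp n) ∈ D)
    (g : EucSp n → ℝ) (hg : ContinuousOn g Dᶜ)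
    (hg0 : Tendsto g ((Filter.cocompact (EucSp n)) ⊓ 𝓟 Dᶜ) (𝓝 0)) :
    ∀ ε > 0, ∃ (N : ℕ) (c : Fin N → ℝ) (k : Fin N → ℕ) (β : Fin N → (Fin n → ℕ)),
      (∀ i, (∑ j, β i j) ≤ k i) ∧
      ∀ y ∈ Dᶜ,
        |g y - ∑ i, c i * (∏ j, (y j) ^ (β i j)) / ‖y‖ ^ (2 * k i)| < ε := by
  classical
  intro ε hε
  obtain ⟨p, hp⟩ := exists_mvPolynomial_near_of_isCompact
    (isCompact_insert_zero_sphereInv_preimage_compl hDo h0)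
    (continuousOn_update_comp_sphereInv hg hg0) hε
  let e := p.support.equivFin.symm
  refine ⟨p.support.card, fun i => p.coeff (e i).1, fun i => ∑ j, (e i).1 j, fun i => (e i).1,
    fun i => le_rfl, fun y hy => ?_⟩
  have hy0 : y ≠ 0 := fun h => hy (h ▸ h0)
  have hpy := hp (sphereInv y) (Or.inr (by simpa using hy))
  rw [Function.update_of_ne (by simpa using hy0), Function.comp_apply, sphereInv_sphereInv,
    abs_sub_comm, MvPolynomial.eval_eq'] at hpy
  convert hpy using 3
  rw [e.sum_comp fun d => p.coeff d.1 * (∏ j, y j ^ d.1 j) / ‖y‖ ^ (2 * ∑ j, d.1 j),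
    Finset.sum_coe_sort p.support
      fun d => p.coeff d * (∏ j, y j ^ d j) / ‖y‖ ^ (2 * ∑ j, d j)]
  refine Finset.sum_congr rfl fun d _ => ?_
  simp only [sphereInv, PiLp.smul_apply, smul_eq_mul, mul_pow, Finset.prod_mul_distrib]
  rw [Finset.prod_pow_eq_pow_sum, inv_pow, ← pow_mul]
  ring
end
end
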